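/- arXiv:2103.13252 — 4 statements merged into one kernel-verified Lean document; each statement's English description precedes it below -/
import Mathlib

section
/- Let 0 < α_p < 1, 0 < α_n < 1, β_p, β_n, c_p, c_n, b, t > 0 and set a = e^{-bt}. For every real u, ∫_ℝ (e^{iux} − 1) ν_Z(x) dx = −(c_p β_p^{α_p} Γ(1−α_p)/(α_p b)) [ ∫_{β_p}^{β_p/a} z^{−1−α_p} (z − iu)^{α_p} dz + log a ] − (c_n β_n^{α_n} Γ(1−α_n)/(α_n b)) [ ∫_{β_n}^{β_n/a} z^{−1−α_n} (z + iu)^{α_n} dz + log a ], where the z-integrals are complex-valued integrals over real intervals with (z ∓ iu)^α the principal complex power. -/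
open MeasureTheory Set

open Filter Topology

theorem integrableOn_rpow_mul_exp_neg_mul {s r : ℝ} (hs : -1 < s) (hr : 0 < r) :
    IntegrableOn (fun x : ℝ ↦ x ^ s * Real.exp (-(r * x))) (Ioi 0) := by
  simpa using integrableOn_rpow_mul_exp_neg_mul_rpow hs one_pos hr

/-- The Laplace transform of `x ^ (s - 1)` on the right half-plane. -/
theorem integral_cexp_neg_mul_rpow_Ioi {s : ℝ} (hs : 0 < s) {w : ℂ} (hw : 0 < w.re) :
    ∫ x : ℝ in Ioi 0, Complex.exp (-(w * x)) * ((x ^ (s - 1) : ℝ) : ℂ) =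
      w ^ (-s : ℂ) * (Real.Gamma s : ℂ) := by
  set μ : Measure ℝ := (volume.restrict (Ioi 0)).withDensity
    fun x ↦ ENNReal.ofReal (x ^ (s - 1)) with hμ
  have hmeas : Measurable fun x : ℝ ↦ ENNReal.ofReal (x ^ (s - 1)) := by fun_prop
  have hfin : ∀ᵐ x ∂(volume.restrict (Ioi (0 : ℝ))), ENNReal.ofReal (x ^ (s - 1)) < ⊤ := by simp
  have hset : Iio (0 : ℝ) ⊆ interior (ProbabilityTheory.integrableExpSet id μ) := by
    refine interior_maximal (fun r hr ↦ ?_) isOpen_Iio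
    change Integrable _ _
    rw [hμ, integrable_withDensity_iff_integrable_smul' hmeas hfin]
    refine (integrableOn_rpow_mul_exp_neg_mul (s := s - 1) (by linarith)
      (neg_pos.2 hr)).congr_fun (fun x hx ↦ ?_) measurableSet_Ioi
    simp [ENNReal.toReal_ofReal (Real.rpow_nonneg (le_of_lt hx) _)]
  have hmgf (z : ℂ) : ProbabilityTheory.complexMGF id μ (-z) =
      ∫ x : ℝ in Ioi 0, Complex.exp (-(z * x)) * ((x ^ (s - 1) : ℝ) : ℂ) := by
    rw [ProbabilityTheory.complexMGF, hμ, integral_withDensity_eq_integral_toReal_smul hmeas hfin]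
    refine setIntegral_congr_fun measurableSet_Ioi fun x hx ↦ ?_
    simp only [ENNReal.toReal_ofReal (Real.rpow_nonneg (le_of_lt hx) _), Complex.real_smul, id]
    rw [mul_comm, neg_mul]
  have hU : IsPreconnected {z : ℂ | 0 < z.re} := (convex_halfSpace_re_gt 0).isPreconnected
  have hUo : IsOpen {z : ℂ | 0 < z.re} := isOpen_lt continuous_const Complex.continuous_re
  have hf : AnalyticOnNhd ℂ (fun z ↦ ProbabilityTheory.complexMGF id μ (-z)) {z | 0 < z.re} := by
    intro z hz
    have : AnalyticAt ℂ (ProbabilityTheory.complexMGF id μ) (-z) :=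
      ProbabilityTheory.analyticAt_complexMGF (hset (by simpa using hz))
    exact this.fun_comp (f := fun z : ℂ ↦ -z) (by fun_prop)
  have hg : AnalyticOnNhd ℂ (fun z : ℂ ↦ z ^ (-s : ℂ) * (Real.Gamma s : ℂ)) {z | 0 < z.re} := by
    intro z hz
    exact (analyticAt_id.cpow analyticAt_const (Or.inl hz)).mul analyticAt_const
  have hreal (r : ℝ) (hr : 0 < r) :
      ProbabilityTheory.complexMGF id μ (-(r : ℂ)) = (r : ℂ) ^ (-s : ℂ) * (Real.Gamma s : ℂ) := by
    rw [hmgf, ← Complex.ofReal_neg, ← Complex.ofReal_cpow hr.le, ← Complex.ofReal_mul]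
    have := Real.integral_rpow_mul_exp_neg_mul_Ioi hs hr
    rw [one_div, Real.inv_rpow hr.le, ← Real.rpow_neg hr.le] at this
    rw [← this, ← integral_complex_ofReal]
    refine integral_congr_ae (.of_forall fun x ↦ ?_)
    push_cast
    ring
  have hfreq : ∃ᶠ z in 𝓝[≠] (1 : ℂ), ProbabilityTheory.complexMGF id μ (-z) =
      z ^ (-s : ℂ) * (Real.Gamma s : ℂ) := by
    have ht : Tendsto (fun r : ℝ ↦ (r : ℂ)) (𝓝[≠] 1) (𝓝[≠] 1) := by
      refine tendsto_nhdsWithin_of_tendsto_nhds_of_eventually_within _ ?_ ?_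
      · exact (Complex.continuous_ofReal.tendsto' 1 1 (by simp)).mono_left nhdsWithin_le_nhds
      · filter_upwards [self_mem_nhdsWithin] with r hr
        simpa using hr
    refine ht.frequently (Eventually.frequently ?_)
    filter_upwards [mem_nhdsWithin_of_mem_nhds (Ioi_mem_nhds (zero_lt_one' ℝ))] with r hr
    exact hreal r hr
  rw [← hmgf]
  exact hf.eqOn_of_preconnected_of_frequently_eq hg hU (by simp) hfreq hw

theorem norm_cexp_sub_one_mul_exp_mul_rpow_le {x : ℝ} (hx : 0 < x) (z s u : ℝ) :
    ‖(Complex.exp (Complex.I * u * x) - 1) * Complex.exp (-(z * x)) * ((x ^ s : ℝ) : ℂ)‖ ≤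
      |u| * (x ^ (s + 1) * Real.exp (-(z * x))) := by
  have h1 : ‖Complex.exp (Complex.I * u * x) - 1‖ ≤ |u| * x := by
    have := Real.norm_exp_I_mul_ofReal_sub_one_le (x := u * x)
    rwa [Complex.ofReal_mul, ← mul_assoc, Real.norm_eq_abs, abs_mul, abs_of_pos hx] at this
  have h2 : ‖Complex.exp (-(z * x))‖ = Real.exp (-(z * x)) := by
    rw [Complex.norm_exp]; simp
  rw [norm_mul, norm_mul, h2, Complex.norm_real, Real.norm_of_nonneg (by positivity),
    Real.rpow_add_one hx.ne']
  calc _ ≤ |u| * x * Real.exp (-(z * x)) * x ^ s := by gcongr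
    _ = _ := by ring

theorem integrableOn_cexp_sub_one_mul_exp_mul_rpow {s z : ℝ} (hs : -2 < s) (hz : 0 < z) (u : ℝ) :
    IntegrableOn (fun x : ℝ ↦ (Complex.exp (Complex.I * u * x) - 1) * Complex.exp (-(z * x)) *
      ((x ^ s : ℝ) : ℂ)) (Ioi 0) := by
  refine ((integrableOn_rpow_mul_exp_neg_mul (s := s + 1) (by linarith) hz).const_mul |u|).mono'
    (by fun_prop) ?_
  filter_upwards [ae_restrict_mem measurableSet_Ioi] with x hx
  exact norm_cexp_sub_one_mul_exp_mul_rpow_le hx z s u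

theorem integrableOn_cexp_neg_mul_rpow {s : ℝ} (hs : -1 < s) {w : ℂ} (hw : 0 < w.re) :
    IntegrableOn (fun x : ℝ ↦ Complex.exp (-(w * x)) * ((x ^ s : ℝ) : ℂ)) (Ioi 0) := by
  refine (integrableOn_rpow_mul_exp_neg_mul hs hw).mono' (by fun_prop) ?_
  filter_upwards [ae_restrict_mem measurableSet_Ioi] with x hx
  rw [norm_mul, Complex.norm_exp, Complex.norm_real,
    Real.norm_of_nonneg (Real.rpow_nonneg (le_of_lt hx) _), mul_comm]
  simp

/-- The characteristic exponent of a one-sided tempered stable Lévy density. -/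
theorem integral_cexp_sub_one_mul_exp_mul_rpow {α z : ℝ} (hα0 : 0 < α) (hα1 : α < 1)
    (hz : 0 < z) (u : ℝ) :
    ∫ x : ℝ in Ioi 0, (Complex.exp (Complex.I * u * x) - 1) * Complex.exp (-(z * x)) *
        ((x ^ (-1 - α) : ℝ) : ℂ) =
      -((Real.Gamma (1 - α) / α : ℝ) : ℂ) *
        (((z : ℂ) - Complex.I * u) ^ (α : ℂ) - (z : ℂ) ^ (α : ℂ)) := by
  set w : ℂ := z - Complex.I * u with hw
  have hwre : 0 < w.re := by simpa [hw] using hz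
  have hw0 : w ≠ 0 := by rintro h; simp [h] at hwre
  have hz0 : (z : ℂ) ≠ 0 := by exact_mod_cast hz.ne'
  have hsplit (x : ℝ) : (Complex.exp (Complex.I * u * x) - 1) * Complex.exp (-(z * x)) =
      Complex.exp (-(w * x)) - Complex.exp (-(z * x)) := by
    rw [sub_mul, one_mul, ← Complex.exp_add]
    congr 2
    rw [hw]; ring
  have hexp (v : ℂ) (x : ℝ) : HasDerivAt (fun x : ℝ ↦ Complex.exp (-(v * x)))
      (Complex.exp (-(v * x)) * (-v)) x := by
    have h := ((hasDerivAt_id (x : ℂ)).const_mul v).neg.cexp.comp_ofReal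
    simpa using h
  have hpow (x : ℝ) (hx : x ∈ Ioi (0 : ℝ)) :
      HasDerivAt (fun x : ℝ ↦ ((-(x ^ (-α) / α) : ℝ) : ℂ)) ((x ^ (-1 - α) : ℝ) : ℂ) x := by
    have h := ((Real.hasDerivAt_rpow_const (p := -α) (Or.inl (ne_of_gt hx))).div_const α).neg
    have h' := h.ofReal_comp
    convert h' using 2
    · rfl
    · rw [show -α - 1 = -1 - α by ring]
      field_simp
  have hlim {l : Filter ℝ} (hl : ∀ᶠ x in l, 0 < x)
      (h : Tendsto (fun x : ℝ ↦ x ^ (1 - α) * Real.exp (-(z * x))) l (𝓝 0)) :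
      Tendsto ((fun x : ℝ ↦ Complex.exp (-(w * x)) - Complex.exp (-(z * x))) *
        fun x : ℝ ↦ ((-(x ^ (-α) / α) : ℝ) : ℂ)) l (𝓝 0) := by
    have h' := (h.const_mul |u|).mul_const (1 / α)
    rw [mul_zero, zero_mul] at h'
    refine squeeze_zero_norm' ?_ h'
    filter_upwards [hl] with x hx
    have := norm_cexp_sub_one_mul_exp_mul_rpow_le hx z (-α) u
    rw [show -α + 1 = 1 - α by ring, hsplit] at this
    calc _ = ‖(Complex.exp (-(w * x)) - Complex.exp (-(z * x))) * ((x ^ (-α) : ℝ) : ℂ)‖ *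
          (1 / α) := by
            simp [abs_of_pos hα0]; ring
      _ ≤ _ := by gcongr
  have key := integral_Ioi_mul_deriv_eq_deriv_mul (a := 0) (a' := (0 : ℂ)) (b' := 0)
    (u := fun x : ℝ ↦ Complex.exp (-(w * x)) - Complex.exp (-(z * x)))
    (u' := fun x : ℝ ↦ Complex.exp (-(w * x)) * (-w) - Complex.exp (-(z * x)) * (-z))
    (v := fun x : ℝ ↦ ((-(x ^ (-α) / α) : ℝ) : ℂ)) (v' := fun x : ℝ ↦ ((x ^ (-1 - α) : ℝ) : ℂ))
    (fun x _ ↦ (hexp w x).sub (hexp z x)) hpow ?_ ?_ ?_ ?_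
  · simp_rw [hsplit]
    rw [key]
    have hG (v : ℂ) (hv : 0 < v.re) := integral_cexp_neg_mul_rpow_Ioi (s := 1 - α) (by linarith) hv
    simp only [show 1 - α - 1 = -α by ring] at hG
    have hI (v : ℂ) (hv : 0 < v.re) := integrableOn_cexp_neg_mul_rpow (s := -α) (by linarith) hv
    have hzre : 0 < (z : ℂ).re := by simpa
    have hpw (v : ℂ) (hv : v ≠ 0) : v * v ^ (-((1 - α : ℝ) : ℂ)) = v ^ (α : ℂ) := by
      nth_rewrite 1 [← Complex.cpow_one v]
      rw [← Complex.cpow_add _ _ hv]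
      congr 1
      push_cast
      ring
    have : ∀ x : ℝ, (Complex.exp (-(w * x)) * (-w) - Complex.exp (-(z * x)) * (-z)) *
        ((-(x ^ (-α) / α) : ℝ) : ℂ) = (w / α) * (Complex.exp (-(w * x)) * ((x ^ (-α) : ℝ) : ℂ)) -
          (z / α) * (Complex.exp (-(z * x)) * ((x ^ (-α) : ℝ) : ℂ)) := by
      intro x
      push_cast
      ring
    simp_rw [this]
    rw [integral_sub ((hI w hwre).const_mul _) ((hI z hzre).const_mul _), integral_const_mul,
      integral_const_mul, hG w hwre, hG z hzre, ← hpw w hw0, ← hpw z hz0]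
    push_cast
    ring
  · refine (integrableOn_cexp_sub_one_mul_exp_mul_rpow (s := -1 - α) (by linarith) hz u).congr_fun
      (fun x _ ↦ ?_) measurableSet_Ioi
    simp only [hsplit, Pi.mul_apply]
  · have hI (v : ℂ) (hv : 0 < v.re) :=
      (integrableOn_cexp_neg_mul_rpow (s := -α) (by linarith) hv).const_mul (v / α)
    refine IntegrableOn.congr_fun ((hI w hwre).sub (hI z (by simpa))) (fun x _ ↦ ?_)
      measurableSet_Ioi
    simp only [Pi.mul_apply, Pi.sub_apply]
    push_cast
    ring
  · refine hlim self_mem_nhdsWithin ?_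
    have : ContinuousAt (fun x : ℝ ↦ x ^ (1 - α) * Real.exp (-(z * x))) 0 :=
      (Real.continuousAt_rpow_const _ _ (Or.inr (by linarith))).mul (by fun_prop)
    have h := this.tendsto.mono_left (nhdsWithin_le_nhds (s := Ioi 0))
    simpa [Real.zero_rpow (by linarith : 1 - α ≠ 0)] using h
  · refine hlim (eventually_gt_atTop 0) ?_
    simpa using tendsto_rpow_mul_exp_neg_mul_atTop_nhds_zero (1 - α) z hz

/-- One side of the Lévy–Khintchine integral of the innovation: the part carried by `Ioi 0`. -/
theorem levyKhintchine_innovation_Ioi {α β c b a : ℝ} (hα0 : 0 < α) (hα1 : α < 1) (hβ : 0 < β)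
    (ha0 : 0 < a) (ha1 : a < 1) {ν : ℝ → ℝ}
    (hν : ∀ x, 0 < x →
      ν x = c / (b * x) * ∫ y in x..(x / a), Real.exp (-(β * y)) * y ^ (-1 - α)) (u : ℝ) :
    IntegrableOn (fun x : ℝ ↦ (Complex.exp (Complex.I * u * x) - 1) * (ν x : ℂ)) (Ioi 0) ∧
    ∫ x : ℝ in Ioi 0, (Complex.exp (Complex.I * u * x) - 1) * (ν x : ℂ) =
      -((c * β ^ α * Real.Gamma (1 - α) / (α * b) : ℝ) : ℂ) *
          ((∫ z in β..(β / a),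
              (z : ℂ) ^ (-1 - α : ℂ) * ((z : ℂ) - Complex.I * u) ^ (α : ℂ)) +
            (Real.log a : ℂ)) := by
  have hle : 1 ≤ 1 / a := (one_le_div ha0).2 ha1.le
  set F : ℝ → ℝ → ℂ := fun x s ↦ (Complex.exp (Complex.I * u * x) - 1) *
    Complex.exp (-((β * s : ℝ) * x)) * ((x ^ (-1 - α) : ℝ) : ℂ) * ((s ^ (-1 - α) : ℝ) : ℂ) with hF
  have hcongr : ∀ x ∈ Ioi (0 : ℝ), (Complex.exp (Complex.I * u * x) - 1) * (ν x : ℂ) =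
      ((c / b : ℝ) : ℂ) * ∫ s in Ioc 1 (1 / a), F x s := by
    intro x hx
    have hx : 0 < x := hx
    have hsub := intervalIntegral.mul_integral_comp_mul_left (a := 1) (b := 1 / a)
      (f := fun y ↦ Real.exp (-(β * y)) * y ^ (-1 - α)) x
    rw [mul_one, mul_one_div] at hsub
    rw [hν x hx, ← hsub, ← mul_assoc, show c / (b * x) * x = c / b by field_simp,
      Complex.ofReal_mul, mul_left_comm, intervalIntegral.integral_of_le hle,
      ← integral_complex_ofReal, ← integral_const_mul]
    congr 1
    refine setIntegral_congr_fun measurableSet_Ioc fun s hs ↦ ?_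
    have hs : 0 < s := one_pos.trans hs.1
    simp only [hF]
    rw [Real.mul_rpow hx.le hs.le, show β * (x * s) = β * s * x by ring]
    push_cast
    ring
  have hFint : Integrable (Function.uncurry F)
      ((volume.restrict (Ioi 0)).prod (volume.restrict (Ioc 1 (1 / a)))) := by
    have h1 : Integrable (fun _ : ℝ ↦ (1 : ℝ)) (volume.restrict (Ioc 1 (1 / a))) :=
      integrable_const _
    have h2 := ((integrableOn_rpow_mul_exp_neg_mul (s := -α) (by linarith) hβ).const_mul |u|)
    refine (h2.mul_prod h1).mono' ?_ ?_
    · simp only [hF, Function.uncurry_def]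
      fun_prop
    · rw [Measure.prod_restrict]
      filter_upwards [ae_restrict_mem (measurableSet_Ioi.prod measurableSet_Ioc)] with p hp
      obtain ⟨hx, hs, -⟩ := hp
      have hx : 0 < p.1 := hx
      have h := norm_cexp_sub_one_mul_exp_mul_rpow_le hx (β * p.2) (-1 - α) u
      rw [show -1 - α + 1 = -α by ring] at h
      have hs1 : p.2 ^ (-1 - α) ≤ 1 := Real.rpow_le_one_of_one_le_of_nonpos hs.le (by linarith)
      have hs0 : 0 ≤ p.2 ^ (-1 - α) := Real.rpow_nonneg (one_pos.trans hs).le _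
      simp only [hF, Function.uncurry_def]
      rw [norm_mul, Complex.norm_real, Real.norm_of_nonneg hs0]
      have hexp : Real.exp (-(β * p.2 * p.1)) ≤ Real.exp (-(β * p.1)) := by
        gcongr
        nlinarith [hs.le]
      have hb : |u| * (p.1 ^ (-α) * Real.exp (-(β * p.2 * p.1))) ≤
          |u| * (p.1 ^ (-α) * Real.exp (-(β * p.1))) := by gcongr
      exact mul_le_mul (h.trans hb) hs1 hs0 (by positivity)
  refine ⟨IntegrableOn.congr_fun (hFint.integral_prod_left.const_mul ((c / b : ℝ) : ℂ))
    (fun x hx ↦ (hcongr x hx).symm) measurableSet_Ioi, ?_⟩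
  rw [setIntegral_congr_fun measurableSet_Ioi hcongr, integral_const_mul,
    integral_integral_swap hFint]
  set H : ℝ → ℂ := fun z ↦ (z : ℂ) ^ (-1 - α : ℂ) *
    (((z : ℂ) - Complex.I * u) ^ (α : ℂ) - (z : ℂ) ^ (α : ℂ)) with hH
  have hinner : ∀ s ∈ Ioc 1 (1 / a), ∫ x in Ioi 0, F x s =
      -((β ^ α * Real.Gamma (1 - α) / α : ℝ) : ℂ) * (β * H (β * s)) := by
    intro s hs
    have hs : 0 < s := one_pos.trans hs.1
    have hpow : (((β * s : ℝ)) : ℂ) ^ (-1 - α : ℂ) =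
        ((β ^ (-1 - α) * s ^ (-1 - α) : ℝ) : ℂ) := by
      rw [← Real.mul_rpow hβ.le hs.le, Complex.ofReal_cpow (by positivity)]
      push_cast
      rfl
    have hβpow : β ^ α * β * β ^ (-1 - α) = 1 := by
      rw [← Real.rpow_add_one hβ.ne', ← Real.rpow_add hβ,
        show α + 1 + (-1 - α) = 0 by ring, Real.rpow_zero]
    simp only [hF, hH]
    rw [integral_mul_const, integral_cexp_sub_one_mul_exp_mul_rpow hα0 hα1 (by positivity), hpow]
    generalize ((((β * s : ℝ)) : ℂ) - Complex.I * u) ^ (α : ℂ) -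
      (((β * s : ℝ)) : ℂ) ^ (α : ℂ) = X
    have hβpow' : ((β ^ α : ℝ) : ℂ) * β * ((β ^ (-1 - α) : ℝ) : ℂ) = 1 := by exact_mod_cast hβpow
    simp only [Complex.ofReal_mul, Complex.ofReal_div]
    linear_combination
      ((Real.Gamma (1 - α) : ℂ) / α * X * ((s ^ (-1 - α) : ℝ) : ℂ)) * hβpow'
  have hβa : β ≤ β / a := (le_div_iff₀ ha0).2 (by nlinarith)
  have hpos : ∀ z ∈ uIcc β (β / a), 0 < z := by
    rw [uIcc_of_le hβa]
    exact fun z hz ↦ hβ.trans_le hz.1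
  have hlog : ∫ z in β..(β / a), ((z⁻¹ : ℝ) : ℂ) = -(Real.log a : ℂ) := by
    rw [intervalIntegral.integral_ofReal, integral_inv_of_pos hβ (by positivity),
      div_right_comm, div_self hβ.ne', one_div, Real.log_inv, Complex.ofReal_neg]
  have hslit (v : ℝ) (z : ℝ) (hz : 0 < z) : (z : ℂ) - Complex.I * v ∈ Complex.slitPlane :=
    Or.inl (by simpa using hz)
  have hcont : ContinuousOn (fun z : ℝ ↦ (z : ℂ) ^ (-1 - α : ℂ) *
      ((z : ℂ) - Complex.I * u) ^ (α : ℂ)) (uIcc β (β / a)) := by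
    refine ContinuousOn.mul ?_ ?_
    · exact ContinuousOn.cpow_const (by fun_prop)
        fun z hz ↦ Complex.ofReal_mem_slitPlane.2 (hpos z hz)
    · exact ContinuousOn.cpow_const (by fun_prop) fun z hz ↦ hslit u z (hpos z hz)
  have hHint : ∫ z in β..(β / a), H z = (∫ z in β..(β / a),
      (z : ℂ) ^ (-1 - α : ℂ) * ((z : ℂ) - Complex.I * u) ^ (α : ℂ)) + (Real.log a : ℂ) := by
    have hinv : ContinuousOn (fun z : ℝ ↦ ((z⁻¹ : ℝ) : ℂ)) (uIcc β (β / a)) :=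
      Complex.continuous_ofReal.comp_continuousOn
        (continuousOn_id.inv₀ fun z hz ↦ (hpos z hz).ne')
    rw [← sub_neg_eq_add, ← hlog,
      ← intervalIntegral.integral_sub hcont.intervalIntegrable hinv.intervalIntegrable]
    refine intervalIntegral.integral_congr fun z hz ↦ ?_
    have hz0 : (z : ℂ) ≠ 0 := by exact_mod_cast (hpos z hz).ne'
    simp only [hH]
    rw [mul_sub, ← Complex.cpow_add _ _ hz0, sub_add_cancel, Complex.cpow_neg_one,
      Complex.ofReal_inv]
  have hsub := intervalIntegral.smul_integral_comp_mul_left (a := 1) (b := 1 / a) H β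
  rw [mul_one, mul_one_div, Complex.real_smul] at hsub
  rw [setIntegral_congr_fun measurableSet_Ioc hinner, integral_const_mul, integral_const_mul,
    ← intervalIntegral.integral_of_le hle, hsub, hHint]
  push_cast
  ring

/-- For `0 < α_p, α_n < 1`, `β_p, β_n, c_p, c_n, b, t > 0` and `a = e^{-bt}`,
the Lévy–Khintchine integral of the OU-BCTS innovation Lévy density satisfies, for all `u ∈ ℝ`,
`∫_ℝ (e^{iux} − 1) ν_Z(x) dx
  = −(c_p β_p^{α_p} Γ(1−α_p)/(α_p b)) [ ∫_{β_p}^{β_p/a} z^{−1−α_p} (z − iu)^{α_p} dz + log a ]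
    − (c_n β_n^{α_n} Γ(1−α_n)/(α_n b)) [ ∫_{β_n}^{β_n/a} z^{−1−α_n} (z + iu)^{α_n} dz + log a ]`,
the `z`-integrals being complex-valued integrals over real intervals with principal powers. -/
theorem ou_bcts_innovation_charexp
    (αp αn βp βn cp cn b t : ℝ)
    (hαp0 : 0 < αp) (hαp1 : αp < 1) (hαn0 : 0 < αn) (hαn1 : αn < 1)
    (hβp : 0 < βp) (hβn : 0 < βn) (hcp : 0 < cp) (hcn : 0 < cn)
    (hb : 0 < b) (ht : 0 < t)
    (a : ℝ) (ha : a = Real.exp (-(b * t)))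
    (νZ : ℝ → ℝ)
    (hνZpos : ∀ x, 0 < x →
      νZ x = cp / (b * x) * ∫ y in x..(x / a), Real.exp (-(βp * y)) * y ^ (-1 - αp))
    (hνZneg : ∀ x : ℝ, x < 0 →
      νZ x = cn / (b * |x|) * ∫ y in |x|..(|x| / a), Real.exp (-(βn * y)) * y ^ (-1 - αn))
    (u : ℝ) :
    ∫ x : ℝ, (Complex.exp (Complex.I * u * x) - 1) * (νZ x : ℂ) =
      -((cp * βp ^ αp * Real.Gamma (1 - αp) / (αp * b) : ℝ) : ℂ) *
          ((∫ z in βp..(βp / a),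
              (z : ℂ) ^ (-1 - αp : ℂ) * ((z : ℂ) - Complex.I * u) ^ (αp : ℂ)) +
            (Real.log a : ℂ)) -
        ((cn * βn ^ αn * Real.Gamma (1 - αn) / (αn * b) : ℝ) : ℂ) *
          ((∫ z in βn..(βn / a),
              (z : ℂ) ^ (-1 - αn : ℂ) * ((z : ℂ) + Complex.I * u) ^ (αn : ℂ)) +
            (Real.log a : ℂ)) := by
  have ha0 : 0 < a := ha ▸ Real.exp_pos _
  have ha1 : a < 1 := by
    rw [ha, Real.exp_lt_one_iff]
    exact neg_neg_of_pos (mul_pos hb ht)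
  obtain ⟨hpi, hp⟩ := levyKhintchine_innovation_Ioi hαp0 hαp1 hβp ha0 ha1 hνZpos u
  obtain ⟨hni, hn⟩ := levyKhintchine_innovation_Ioi (ν := fun x ↦ νZ (-x)) hαn0 hαn1 hβn ha0 ha1
    (fun x hx ↦ by
      have h := hνZneg (-x) (neg_neg_of_pos hx)
      rwa [abs_neg, abs_of_pos hx] at h) (-u)
  set f : ℝ → ℂ := fun x ↦ (Complex.exp (Complex.I * u * x) - 1) * (νZ x : ℂ) with hf
  have hneg (x : ℝ) : (Complex.exp (Complex.I * ((-u : ℝ) : ℂ) * x) - 1) * (νZ (-x) : ℂ) =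
      f (-x) := by
    simp [hf]
  simp only [hneg] at hni hn
  have hni' : IntegrableOn f (Iic 0) := by
    rw [integrableOn_Iic_iff_integrableOn_Iio, ← neg_zero]
    have h := IntegrableOn.comp_neg_Iio (c := 0) (f := fun x ↦ f (-x)) (by rwa [neg_zero])
    simpa only [neg_neg, neg_zero] using h
  rw [integral_comp_neg_Ioi, neg_zero] at hn
  rw [← intervalIntegral.integral_Iic_add_Ioi hni' hpi, hp, hn]
  simp only [Complex.ofReal_neg, mul_neg, sub_neg_eq_add]
  ring
end

section
/- Let 0 < α < 1, β > 0, c > 0, b > 0, t > 0 and set a = e^{-bt}. For every real s with s < β, the function x ↦ (e^{sx} − 1) ν_Z(x) is Lebesgue integrable on (0, ∞) and ∫_0^∞ (e^{sx} − 1) ν_Z(x) dx = −(c β^α Γ(1−α)/(α b)) [ ∫_β^{β/a} z^{−1−α} (z − s)^α dz + log a ]. (All quantities here are real: z − s > 0 for z ∈ [β, β/a].) -/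
open MeasureTheory Set

/-- Fubini for a measurable kernel of constant sign `ε` on `(A, B] × (0, ∞)`. -/
lemma integrableOn_integral_swap_of_sign {f : ℝ → ℝ → ℝ} {g : ℝ → ℝ} {A B ε : ℝ} (hAB : A ≤ B)
    (hf : Measurable (Function.uncurry f))
    (hsign : ∀ u ∈ Ioc A B, ∀ x ∈ Ioi (0 : ℝ), ‖f u x‖ = ε * f u x)
    (hint : ∀ u ∈ Ioc A B, IntegrableOn (f u) (Ioi 0))
    (hg : ∀ u ∈ Ioc A B, ∫ x in Ioi (0 : ℝ), f u x = g u)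
    (hgint : IntegrableOn g (Ioc A B)) :
    IntegrableOn (fun x => ∫ u in A..B, f u x) (Ioi 0) ∧
      ∫ x in Ioi (0 : ℝ), ∫ u in A..B, f u x = ∫ u in A..B, g u := by
  have hprod : Integrable (Function.uncurry f)
      ((volume.restrict (Ioc A B)).prod (volume.restrict (Ioi (0 : ℝ)))) := by
    rw [integrable_prod_iff hf.aestronglyMeasurable]
    refine ⟨(ae_restrict_mem measurableSet_Ioc).mono hint, ?_⟩
    refine (hgint.const_mul ε).congr ?_
    filter_upwards [ae_restrict_mem measurableSet_Ioc] with u hu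
    rw [← hg u hu, ← integral_const_mul]
    exact setIntegral_congr_fun measurableSet_Ioi fun x hx => (hsign u hu x hx).symm
  simp only [intervalIntegral.integral_of_le hAB]
  refine ⟨hprod.integral_prod_right, ?_⟩
  rw [← integral_integral_swap hprod]
  exact setIntegral_congr_fun measurableSet_Ioc hg

lemma integrableOn_and_integral_rpow_neg_mul_exp {α r : ℝ} (hα1 : α < 1) (hr : 0 < r) :
    IntegrableOn (fun x : ℝ => x ^ (-α) * Real.exp (-(r * x))) (Ioi 0) ∧
      ∫ x in Ioi (0 : ℝ), x ^ (-α) * Real.exp (-(r * x)) = Real.Gamma (1 - α) * r ^ (α - 1) := by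
  have h := Real.integral_rpow_mul_exp_neg_mul_Ioi (a := 1 - α) (by linarith) hr
  rw [sub_sub_cancel_left, one_div, Real.inv_rpow hr.le, ← Real.rpow_neg hr.le, neg_sub,
    mul_comm] at h
  refine ⟨?_, h⟩
  by_contra hni
  have hpos : 0 < Real.Gamma (1 - α) * r ^ (α - 1) :=
    mul_pos (Real.Gamma_pos_of_pos (by linarith)) (Real.rpow_pos_of_pos hr _)
  rw [integral_undef hni] at h
  exact hpos.ne h

lemma integral_rpow_mul_exp_neg_mul (α p q : ℝ) {x : ℝ} (hx : 0 < x) :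
    ∫ r in q..p, x ^ (-α) * Real.exp (-(r * x)) =
      (Real.exp (-(q * x)) - Real.exp (-(p * x))) * x ^ (-1 - α) := by
  have hderiv (r : ℝ) : HasDerivAt (fun r => -(x ^ (-1 - α) * Real.exp (-(r * x))))
      (x ^ (-α) * Real.exp (-(r * x))) r := by
    have h := (((((hasDerivAt_id r).mul_const x).neg).exp).const_mul (x ^ (-1 - α))).neg
    refine h.congr_deriv ?_
    have hpow : x ^ (-α) = x ^ (-1 - α) * x := by
      rw [← Real.rpow_add_one hx.ne']; ring_nf
    simp only [hpow, id, Pi.neg_apply]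
    ring
  rw [intervalIntegral.integral_eq_sub_of_hasDerivAt (fun r _ => hderiv r)
    (by apply Continuous.intervalIntegrable; fun_prop)]
  ring

/-- The Laplace exponent of a stable subordinator, in difference form. -/
lemma integrableOn_and_integral_exp_sub_exp_mul_rpow {α p q : ℝ} (hα0 : 0 < α) (hα1 : α < 1)
    (hp : 0 < p) (hq : 0 < q) :
    IntegrableOn
        (fun x : ℝ => (Real.exp (-(q * x)) - Real.exp (-(p * x))) * x ^ (-1 - α)) (Ioi 0) ∧
      ∫ x in Ioi (0 : ℝ), (Real.exp (-(q * x)) - Real.exp (-(p * x))) * x ^ (-1 - α) =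
        Real.Gamma (1 - α) / α * (p ^ α - q ^ α) := by
  wlog hqp : q ≤ p generalizing p q
  · obtain ⟨h1, h2⟩ := this hq hp (le_of_not_ge hqp)
    have hneg (x : ℝ) : (Real.exp (-(q * x)) - Real.exp (-(p * x))) * x ^ (-1 - α) =
        -((Real.exp (-(p * x)) - Real.exp (-(q * x))) * x ^ (-1 - α)) := by ring
    simp only [hneg]
    refine ⟨h1.neg, ?_⟩
    rw [integral_neg, h2]
    ring
  have hcont : IntervalIntegrable (fun r : ℝ => Real.Gamma (1 - α) * r ^ (α - 1)) volume q p :=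
    (intervalIntegral.intervalIntegrable_rpow' (by linarith)).const_mul _
  obtain ⟨h1, h2⟩ := integrableOn_integral_swap_of_sign
    (f := fun r x => x ^ (-α) * Real.exp (-(r * x)))
    (g := fun r => Real.Gamma (1 - α) * r ^ (α - 1)) (ε := 1) hqp
    (by unfold Function.uncurry; fun_prop)
    (fun r _ x hx => by
      rw [one_mul, Real.norm_of_nonneg]
      exact mul_nonneg (Real.rpow_nonneg (le_of_lt hx) _) (Real.exp_pos _).le)
    (fun r hr => (integrableOn_and_integral_rpow_neg_mul_exp hα1 (hq.trans hr.1)).1)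
    (fun r hr => (integrableOn_and_integral_rpow_neg_mul_exp hα1 (hq.trans hr.1)).2)
    ((intervalIntegrable_iff_integrableOn_Ioc_of_le hqp).1 hcont)
  have hcongr : EqOn (fun x : ℝ => ∫ r in q..p, x ^ (-α) * Real.exp (-(r * x)))
      (fun x => (Real.exp (-(q * x)) - Real.exp (-(p * x))) * x ^ (-1 - α)) (Ioi 0) :=
    fun x hx => integral_rpow_mul_exp_neg_mul α p q hx
  refine ⟨h1.congr_fun hcongr measurableSet_Ioi, ?_⟩
  rw [← setIntegral_congr_fun measurableSet_Ioi hcongr, h2, intervalIntegral.integral_const_mul,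
    integral_rpow (Or.inl (by linarith)), sub_add_cancel]
  ring

lemma abs_exp_mul_sub_one {s x : ℝ} (hx : 0 < x) :
    |Real.exp (s * x) - 1| = (if 0 ≤ s then 1 else -1) * (Real.exp (s * x) - 1) := by
  split_ifs with h
  · rw [one_mul, abs_of_nonneg (sub_nonneg.2 (Real.one_le_exp (mul_nonneg h hx.le)))]
  · rw [neg_one_mul, abs_of_nonpos (sub_nonpos.2 (Real.exp_le_one_iff.2
      (mul_nonpos_of_nonpos_of_nonneg (le_of_not_ge h) hx.le)))]

/-- For `0 < α < 1`, `β, c, b, t > 0`, `a = e^{-bt}` and any real `s < β`,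
the function `x ↦ (e^{sx} − 1) ν_Z(x)` is Lebesgue integrable on `(0, ∞)` and
`∫_0^∞ (e^{sx} − 1) ν_Z(x) dx
  = −(c β^α Γ(1−α)/(α b)) [ ∫_β^{β/a} z^{−1−α} (z − s)^α dz + log a ]`,
all quantities being real (`z − s > 0` on `[β, β/a]`). This is the cumulant generating
function of the OU-CTS innovation `Z(t)`. -/
theorem ou_cts_innovation_cgf
    (α β c b t : ℝ) (hα0 : 0 < α) (hα1 : α < 1)
    (hβ : 0 < β) (hc : 0 < c) (hb : 0 < b) (ht : 0 < t)
    (a : ℝ) (ha : a = Real.exp (-(b * t)))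
    (νZ : ℝ → ℝ)
    (hνZ : ∀ x, 0 < x →
      νZ x = c / (b * x) * ∫ y in x..(x / a), Real.exp (-(β * y)) * y ^ (-1 - α))
    (s : ℝ) (hs : s < β) :
    IntegrableOn (fun x : ℝ => (Real.exp (s * x) - 1) * νZ x) (Ioi 0) volume ∧
      ∫ x in Ioi (0 : ℝ), (Real.exp (s * x) - 1) * νZ x =
        -(c * β ^ α * Real.Gamma (1 - α) / (α * b)) *
          ((∫ z in β..(β / a), z ^ (-1 - α) * (z - s) ^ α) + Real.log a) := by
  have ha0 : 0 < a := ha ▸ Real.exp_pos _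
  have ha1 : a ≤ 1 := by
    rw [ha, Real.exp_le_one_iff]
    have := mul_pos hb ht
    linarith
  have hβa : β ≤ β / a := by rw [le_div_iff₀ ha0]; nlinarith
  -- the kernel in the variables `z = β y / x` and `x`
  set K : ℝ → ℝ → ℝ := fun z x =>
    c / b * β ^ α * z ^ (-1 - α) *
      ((Real.exp (s * x) - 1) * Real.exp (-(z * x)) * x ^ (-1 - α)) with hK
  have hK' (z x : ℝ) : K z x = c / b * β ^ α * z ^ (-1 - α) *
      ((Real.exp (-((z - s) * x)) - Real.exp (-(z * x))) * x ^ (-1 - α)) := by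
    have hexp : Real.exp (-((z - s) * x)) = Real.exp (s * x) * Real.exp (-(z * x)) := by
      rw [← Real.exp_add]; ring_nf
    rw [hexp]
    ring
  have hcont1 : ContinuousOn (fun z : ℝ => z ^ (-1 - α)) (uIcc β (β / a)) := fun z hz => by
    rw [uIcc_of_le hβa] at hz
    exact (Real.continuousAt_rpow_const z _ (Or.inl (hβ.trans_le hz.1).ne')).continuousWithinAt
  have hint1 : IntervalIntegrable (fun z : ℝ => z ^ (-1 - α) * (z - s) ^ α)
      volume β (β / a) := by
    refine (hcont1.mul ?_).intervalIntegrable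
    exact ((continuous_id.sub continuous_const).rpow_const fun _ => Or.inr hα0.le).continuousOn
  have hint2 : IntervalIntegrable (fun z : ℝ => z⁻¹) volume β (β / a) := by
    refine intervalIntegral.intervalIntegrable_inv (fun z hz => ?_) continuousOn_id
    rw [uIcc_of_le hβa] at hz
    exact (hβ.trans_le hz.1).ne'
  set C : ℝ := -(c * β ^ α * Real.Gamma (1 - α) / (α * b)) with hC
  obtain ⟨h1, h2⟩ := integrableOn_integral_swap_of_sign (f := K)
    (g := fun z => C * (z ^ (-1 - α) * (z - s) ^ α - z⁻¹)) (ε := if 0 ≤ s then 1 else -1) hβa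
    (by unfold Function.uncurry; fun_prop)
    (fun z hz x hx => by
      have hz0 : 0 < z := hβ.trans hz.1
      have hx0 : 0 < x := hx
      have hA : 0 ≤ c / b * β ^ α * z ^ (-1 - α) := by positivity
      have hB : 0 ≤ x ^ (-1 - α) := by positivity
      simp only [hK, norm_mul (c / b * β ^ α * z ^ (-1 - α)), Real.norm_of_nonneg hA]
      rw [norm_mul, norm_mul, Real.norm_of_nonneg hB, Real.norm_of_nonneg (Real.exp_pos _).le,
        Real.norm_eq_abs, abs_exp_mul_sub_one hx0]
      ring)
    (fun z hz => by
      have hz0 : 0 < z := hβ.trans hz.1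
      have hzs : 0 < z - s := by linarith [hz.1]
      simp only [funext (hK' z)]
      exact (integrableOn_and_integral_exp_sub_exp_mul_rpow hα0 hα1 hz0 hzs).1.const_mul _)
    (fun z hz => by
      have hz0 : 0 < z := hβ.trans hz.1
      have hzs : 0 < z - s := by linarith [hz.1]
      have hinv : z⁻¹ = z ^ (-1 - α) * z ^ α := by
        rw [← Real.rpow_add hz0, sub_add_cancel, Real.rpow_neg_one]
      simp only [hK']
      rw [integral_const_mul,
        (integrableOn_and_integral_exp_sub_exp_mul_rpow hα0 hα1 hz0 hzs).2, hinv, hC]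
      field_simp
      ring)
    ((intervalIntegrable_iff_integrableOn_Ioc_of_le hβa).1 ((hint1.sub hint2).const_mul C))
  have hcongr : EqOn (fun x => ∫ z in β..(β / a), K z x)
      (fun x => (Real.exp (s * x) - 1) * νZ x) (Ioi 0) := by
    intro x hx
    have hx0 : 0 < x := hx
    have hk : 0 < x / β := div_pos hx0 hβ
    have hsub := intervalIntegral.mul_integral_comp_mul_left (a := β) (b := β / a)
      (f := fun y : ℝ => Real.exp (-(β * y)) * y ^ (-1 - α)) (x / β)
    rw [div_mul_cancel₀ x hβ.ne', show x / β * (β / a) = x / a by field_simp] at hsub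
    simp only [hνZ x hx0, ← hsub]
    rw [← intervalIntegral.integral_const_mul, ← intervalIntegral.integral_const_mul,
      ← intervalIntegral.integral_const_mul]
    refine intervalIntegral.integral_congr fun z hz => ?_
    rw [uIcc_of_le hβa] at hz
    have hz0 : 0 < z := hβ.trans_le hz.1
    have hpow : (x / β * z) ^ (-1 - α) = x ^ (-1 - α) * (β ^ α * β) * z ^ (-1 - α) := by
      rw [Real.mul_rpow hk.le hz0.le, Real.div_rpow hx0.le hβ.le, ← Real.rpow_add_one hβ.ne',
        div_eq_mul_inv, ← Real.rpow_neg hβ.le]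
      ring_nf
    have harg : β * (x / β * z) = z * x := by field_simp
    simp only [hK, hpow, harg]
    field_simp
  refine ⟨h1.congr_fun hcongr measurableSet_Ioi, ?_⟩
  rw [← setIntegral_congr_fun measurableSet_Ioi hcongr, h2, intervalIntegral.integral_const_mul,
    intervalIntegral.integral_sub hint1 hint2, integral_inv_of_pos hβ (div_pos hβ ha0),
    div_div_cancel_left' hβ.ne', Real.log_inv, sub_neg_eq_add]
end

section
/- Let 0 < α < 1, β > 0, c > 0, b > 0, t > 0, set a = e^{-bt}, D = 1 − a^α + a^α log(a^α), Λ = (c β^α Γ(1−α)/(b α² a^α)) · D, and let f_J(x) = (α a^α / D) ∫_1^{1/a} (x^{−α} (βv)^{1−α} e^{−βvx} / Γ(1−α)) · ((v^α − 1)/v) dv for x > 0. Then for every real u, ∫_0^∞ (e^{iux} − 1) ν_Z(x) dx = (c(1 − a^α)/(α b)) Γ(−α) [ ((β/a) − iu)^α − (β/a)^α ] + Λ ( ∫_0^∞ e^{iux} f_J(x) dx − 1 ), i.e. the characteristic exponent of the innovation Z(t) splits into the characteristic exponent of a CTS(α, β/a, c(1−a^α)/(αb)) random variable plus that of an independent compound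 Poisson random variable with intensity Λ and jump density f_J. Complex powers are principal-branch powers. -/
open MeasureTheory Set

theorem integrableOn_rpow_mul_exp_neg_mul_Ioi {s r : ℝ} (hs : -1 < s) (hr : 0 < r) :
    IntegrableOn (fun x : ℝ => x ^ s * Real.exp (-(r * x))) (Ioi 0) := by
  simpa using integrableOn_rpow_mul_exp_neg_mul_rpow (p := 1) hs one_pos hr

/-- `Complex.integral_cpow_mul_exp_neg_mul_Ioi` for a complex rate with positive real part. -/
theorem integral_cpow_mul_exp_neg_complex_mul_Ioi {s w : ℂ} (hs : 0 < s.re) (hw : 0 < w.re) :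
    ∫ x in Ioi (0 : ℝ), (x : ℂ) ^ (s - 1) * Complex.exp (-(w * x)) =
      (1 / w) ^ s * Complex.Gamma s := by
  have hopen : IsOpen {w : ℂ | 0 < w.re} := isOpen_lt continuous_const Complex.continuous_re
  have hconv : Convex ℝ {w : ℂ | 0 < w.re} := convex_halfSpace_re_gt 0
  have hmeas : ∀ w : ℂ, Measurable fun x : ℝ => (x : ℂ) ^ (s - 1) * Complex.exp (-(w * x)) := by
    intro w; fun_prop
  have hnorm : ∀ (w : ℂ) (x : ℝ), 0 < x →
      ‖(x : ℂ) ^ (s - 1) * Complex.exp (-(w * x))‖ = x ^ (s.re - 1) * Real.exp (-(w.re * x)) := by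
    intro w x hx
    rw [norm_mul, Complex.norm_cpow_eq_rpow_re_of_pos hx, Complex.norm_exp]
    simp
  have hleft : AnalyticOnNhd ℂ
      (fun w => ∫ x in Ioi (0 : ℝ), (x : ℂ) ^ (s - 1) * Complex.exp (-(w * x)))
      {w : ℂ | 0 < w.re} := by
    refine DifferentiableOn.analyticOnNhd (fun w₀ hw₀ => ?_) hopen
    have hw₀ : 0 < w₀.re := hw₀
    have hre : ∀ w ∈ Metric.ball w₀ (w₀.re / 2), w₀.re / 2 ≤ w.re := by
      intro w hw
      have h1 := Complex.abs_re_le_norm (w - w₀)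
      rw [mem_ball_iff_norm] at hw
      rw [Complex.sub_re] at h1
      linarith [neg_le_of_abs_le h1]
    refine (hasDerivAt_integral_of_dominated_loc_of_deriv_le
      (F := fun (w : ℂ) (x : ℝ) => (x : ℂ) ^ (s - 1) * Complex.exp (-(w * x)))
      (F' := fun (w : ℂ) (x : ℝ) => (x : ℂ) ^ (s - 1) * Complex.exp (-(w * x)) * -(x : ℂ))
      (bound := fun x => x ^ s.re * Real.exp (-(w₀.re / 2 * x)))
      (Metric.ball_mem_nhds w₀ (half_pos hw₀))
      (Filter.Eventually.of_forall fun w => (hmeas w).aestronglyMeasurable) ?_ ?_ ?_ ?_ ?_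
      ).2.differentiableAt.differentiableWithinAt
    · refine (integrableOn_rpow_mul_exp_neg_mul_Ioi (s := s.re - 1) (by linarith) hw₀).mono'
        (hmeas w₀).aestronglyMeasurable ?_
      filter_upwards [ae_restrict_mem measurableSet_Ioi] with x hx
      exact (hnorm w₀ x hx).le
    · exact ((hmeas w₀).mul (by fun_prop)).aestronglyMeasurable
    · filter_upwards [ae_restrict_mem measurableSet_Ioi] with x (hx : 0 < x) w hw
      rw [norm_mul, hnorm w x hx, norm_neg, Complex.norm_real, Real.norm_of_nonneg hx.le,
        Real.rpow_sub_one hx.ne']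
      have := hre w hw
      calc _ = x ^ s.re * Real.exp (-(w.re * x)) := by field_simp
        _ ≤ _ := by gcongr
    · exact integrableOn_rpow_mul_exp_neg_mul_Ioi (by linarith) (half_pos hw₀)
    · filter_upwards with x w _
      have h : HasDerivAt (fun w : ℂ => -(w * (x : ℂ))) (-(1 * (x : ℂ))) w :=
        ((hasDerivAt_id w).mul_const (x : ℂ)).neg
      rw [one_mul] at h
      simpa only [mul_assoc] using h.cexp.const_mul ((x : ℂ) ^ (s - 1))
  have hright : AnalyticOnNhd ℂ (fun w => (1 / w) ^ s * Complex.Gamma s) {w : ℂ | 0 < w.re} := by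
    refine DifferentiableOn.analyticOnNhd (fun w₀ hw₀ => ?_) hopen
    have hw₀ : 0 < w₀.re := hw₀
    have hne : w₀ ≠ 0 := fun h => by simp [h] at hw₀
    have hslit : 1 / w₀ ∈ Complex.slitPlane := by
      left
      rw [one_div, Complex.inv_re]
      exact div_pos hw₀ (Complex.normSq_pos.2 hne)
    have h1 : DifferentiableAt ℂ (fun w : ℂ => 1 / w) w₀ := by fun_prop (disch := exact hne)
    exact ((h1.cpow_const hslit).mul_const _).differentiableWithinAt
  refine hleft.eqOn_of_preconnected_of_frequently_eq hright hconv.isPreconnected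
    (show (1 : ℂ) ∈ {w : ℂ | 0 < w.re} by simp) ?_ hw
  have htend : Filter.Tendsto (fun r : ℝ => (r : ℂ)) (nhdsWithin 1 {1}ᶜ)
      (nhdsWithin 1 {1}ᶜ) := by
    refine tendsto_nhdsWithin_iff.2 ⟨?_, ?_⟩
    · exact (Complex.continuous_ofReal.tendsto' 1 1 Complex.ofReal_one).mono_left nhdsWithin_le_nhds
    · filter_upwards [self_mem_nhdsWithin] with r hr
      simpa using hr
  refine htend.frequently (Filter.Eventually.frequently ?_)
  filter_upwards [nhdsWithin_le_nhds (lt_mem_nhds (one_pos : (0 : ℝ) < 1))] with r hr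
  exact Complex.integral_cpow_mul_exp_neg_mul_Ioi hs hr

/-- Integration by parts separates the tempered stable part of the OU innovation density. -/
theorem integral_exp_neg_mul_rpow_eq (α β a x : ℝ) (hα0 : 0 < α)
    (ha0 : 0 < a) (ha1 : a < 1) (hx : 0 < x) :
    ∫ y in x..(x / a), Real.exp (-(β * y)) * y ^ (-1 - α) =
      x ^ (-α) * ((1 - a ^ α) / α * Real.exp (-(β / a * x)) +
        x * (β / α) * ∫ v in (1 : ℝ)..(1 / a), v ^ (-α) * Real.exp (-(β * v * x)) * (v ^ α - 1)) := by
  have h1a : 1 ≤ 1 / a := by rw [le_div_iff₀ ha0]; linarith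
  have hpos : ∀ v ∈ uIcc (1 : ℝ) (1 / a), 0 < v := by
    intro v hv
    rw [uIcc_of_le h1a] at hv
    linarith [hv.1]
  have hsub := intervalIntegral.mul_integral_comp_mul_left (a := 1) (b := 1 / a)
    (f := fun y => Real.exp (-(β * y)) * y ^ (-1 - α)) x
  rw [mul_one, mul_one_div] at hsub
  rw [← hsub]
  have hpow : ∀ v ∈ uIcc (1 : ℝ) (1 / a), Real.exp (-(β * (x * v))) * (x * v) ^ (-1 - α) =
      x ^ (-1 - α) * (Real.exp (-(β * v * x)) * v ^ (-1 - α)) := by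
    intro v hv
    rw [Real.mul_rpow hx.le (hpos v hv).le, show β * (x * v) = β * v * x by ring]
    ring
  rw [intervalIntegral.integral_congr hpow, intervalIntegral.integral_const_mul]
  have hparts := intervalIntegral.integral_mul_deriv_eq_deriv_mul (a := 1) (b := 1 / a)
    (u := fun v => Real.exp (-(β * v * x))) (u' := fun v => -(β * x) * Real.exp (-(β * v * x)))
    (v := fun v => (1 - v ^ (-α)) / α) (v' := fun v => v ^ (-1 - α))
    (by
      intro v _
      have h : HasDerivAt (fun v : ℝ => -(β * v * x)) (-(β * 1 * x)) v :=
        (((hasDerivAt_id v).const_mul β).mul_const x).neg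
      convert! h.exp using 1
      ring)
    (by
      intro v hv
      have h := ((Real.hasDerivAt_rpow_const (x := v) (p := -α)
        (Or.inl (hpos v hv).ne')).const_sub 1).div_const α
      convert! h using 1
      rw [show -α - 1 = -1 - α by ring]
      field_simp)
    (by apply Continuous.intervalIntegrable; fun_prop)
    (by
      apply ContinuousOn.intervalIntegrable
      intro v hv
      exact (Real.continuousAt_rpow_const v _ (Or.inl (hpos v hv).ne')).continuousWithinAt)
  rw [hparts]
  have hcongr : ∀ v ∈ uIcc (1 : ℝ) (1 / a),
      -(β * x) * Real.exp (-(β * v * x)) * ((1 - v ^ (-α)) / α) =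
        -(β * x / α) * (v ^ (-α) * Real.exp (-(β * v * x)) * (v ^ α - 1)) := by
    intro v hv
    have : v ^ (-α) * v ^ α = 1 := by
      rw [← Real.rpow_add (hpos v hv)]; simp
    linear_combination (β * x / α * Real.exp (-(β * v * x))) * this
  rw [intervalIntegral.integral_congr hcongr, intervalIntegral.integral_const_mul]
  have hxp : x * x ^ (-1 - α) = x ^ (-α) := by
    rw [← Real.rpow_one_add' hx.le (by linarith)]; congr 1; ring
  have hap : (1 / a) ^ (-α) = a ^ α := by
    rw [one_div, Real.inv_rpow ha0.le, Real.rpow_neg ha0.le, inv_inv]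
  rw [hap, Real.one_rpow, ← hxp, show β * (1 / a) * x = β / a * x by ring]
  ring

/-- The Lévy–Khintchine integral of a classical tempered stable subordinator. -/
theorem integral_exp_sub_one_mul_tempered_stable {α θ : ℝ} (hα0 : 0 < α) (hα1 : α < 1)
    (hθ : 0 < θ) (u : ℝ) :
    IntegrableOn (fun x : ℝ => (Complex.exp (Complex.I * u * x) - 1) *
        ((x ^ (-1 - α) * Real.exp (-(θ * x)) : ℝ) : ℂ)) (Ioi 0) ∧
      ∫ x in Ioi (0 : ℝ), (Complex.exp (Complex.I * u * x) - 1) *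
        ((x ^ (-1 - α) * Real.exp (-(θ * x)) : ℝ) : ℂ) =
      (Real.Gamma (-α) : ℂ) * (((θ : ℂ) - Complex.I * u) ^ (α : ℂ) - (θ : ℂ) ^ (α : ℂ)) := by
  have hbase := integrableOn_rpow_mul_exp_neg_mul_Ioi (s := -α) (by linarith) hθ
  have hmeas : Measurable (fun x : ℝ => (Complex.exp (Complex.I * u * x) - 1) *
        ((x ^ (-1 - α) * Real.exp (-(θ * x)) : ℝ) : ℂ)) := by fun_prop
  have hnorm : ∀ x : ℝ, ‖Complex.exp (Complex.I * u * x) - 1‖ ≤ |u| * |x| := by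
    intro x
    have := Real.norm_exp_I_mul_ofReal_sub_one_le (x := u * x)
    rwa [Real.norm_eq_abs, abs_mul, Complex.ofReal_mul, ← mul_assoc] at this
  have hint : IntegrableOn (fun x : ℝ => (Complex.exp (Complex.I * u * x) - 1) *
        ((x ^ (-1 - α) * Real.exp (-(θ * x)) : ℝ) : ℂ)) (Ioi 0) := by
    refine (hbase.const_mul |u|).mono' hmeas.aestronglyMeasurable ?_
    filter_upwards [ae_restrict_mem measurableSet_Ioi] with x (hx : 0 < x)
    have hxp : x * x ^ (-1 - α) = x ^ (-α) := by
      rw [← Real.rpow_one_add' hx.le (by linarith)]; congr 1; ring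
    rw [norm_mul, Complex.norm_real, Real.norm_of_nonneg (by positivity)]
    calc _ ≤ |u| * |x| * (x ^ (-1 - α) * Real.exp (-(θ * x))) := by
          gcongr; exact hnorm x
      _ = _ := by rw [abs_of_pos hx, ← hxp]; ring
  refine ⟨hint, ?_⟩
  set z : ℂ := (θ : ℂ) - Complex.I * u with hz
  have hexp : ∀ x : ℝ, Complex.exp (-(z * x)) = Complex.exp (Complex.I * u * x) *
      Complex.exp (-(θ * x)) := by
    intro x
    rw [← Complex.exp_add, hz]; congr 1; ring
  have hgint : ∀ w : ℂ, w.re = θ →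
      IntegrableOn (fun x : ℝ => ((x ^ (-α) : ℝ) : ℂ) * Complex.exp (-(w * x))) (Ioi 0) := by
    intro w hw
    refine hbase.mono' (Measurable.aestronglyMeasurable (by fun_prop)) ?_
    filter_upwards [ae_restrict_mem measurableSet_Ioi] with x (hx : 0 < x)
    rw [norm_mul, Complex.norm_real, Real.norm_of_nonneg (by positivity), Complex.norm_exp]
    simp [hw]
  have hgamma : ∀ w : ℂ, w.re = θ →
      w * ∫ x in Ioi (0 : ℝ), ((x ^ (-α) : ℝ) : ℂ) * Complex.exp (-(w * x)) =
        w ^ (α : ℂ) * Real.Gamma (1 - α) := by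
    intro w hw
    have hwre : 0 < w.re := hw ▸ hθ
    have hw0 : w ≠ 0 := fun h => by simp [h] at hwre
    have h := integral_cpow_mul_exp_neg_complex_mul_Ioi (s := ((1 - α : ℝ) : ℂ)) (w := w)
      (by rw [Complex.ofReal_re]; linarith) hwre
    have hc : ∫ x in Ioi (0 : ℝ), ((x ^ (-α) : ℝ) : ℂ) * Complex.exp (-(w * x)) =
        ∫ x in Ioi (0 : ℝ), (x : ℂ) ^ (((1 - α : ℝ) : ℂ) - 1) * Complex.exp (-(w * x)) := by
      refine setIntegral_congr_fun measurableSet_Ioi fun x hx => ?_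
      rw [Complex.ofReal_cpow (le_of_lt hx)]
      congr 2
      push_cast; ring
    have harg : w.arg ≠ Real.pi := fun h => by
      have := (Complex.arg_eq_pi_iff.1 h).1
      linarith
    rw [hc, h, Complex.Gamma_ofReal, one_div, Complex.inv_cpow _ _ harg, ← Complex.cpow_neg,
      ← mul_assoc]
    congr 1
    nth_rewrite 1 [← Complex.cpow_one w]
    rw [← Complex.cpow_add _ _ hw0]
    congr 1
    push_cast; ring
  have hαne : (α : ℂ) ≠ 0 := by exact_mod_cast hα0.ne'
  have hprod : ∀ x : ℝ, 0 < x → ‖(Complex.exp (-(z * x)) - Complex.exp (-(θ * x))) *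
      ((-(x ^ (-α)) / α : ℝ) : ℂ)‖ ≤ |u| / α * (x ^ (1 - α) * Real.exp (-(θ * x))) := by
    intro x hx
    rw [hexp, ← sub_one_mul, norm_mul, norm_mul, Complex.norm_real,
      show Complex.exp (-(θ * x)) = (Real.exp (-(θ * x)) : ℂ) by push_cast; rfl,
      Complex.norm_real, Real.norm_of_nonneg (Real.exp_pos _).le, Real.norm_eq_abs, neg_div,
      abs_neg, abs_of_nonneg (by positivity)]
    calc _ ≤ |u| * |x| * Real.exp (-(θ * x)) * (x ^ (-α) / α) := by
          gcongr; exact hnorm x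
      _ = _ := by
        rw [abs_of_pos hx, sub_eq_add_neg, Real.rpow_one_add' hx.le (by linarith)]; ring
  have hbp := integral_Ioi_mul_deriv_eq_deriv_mul (a := (0 : ℝ)) (a' := (0 : ℂ)) (b' := (0 : ℂ))
    (u := fun x : ℝ => Complex.exp (-(z * x)) - Complex.exp (-(θ * x)))
    (u' := fun x : ℝ => -z * Complex.exp (-(z * x)) + θ * Complex.exp (-(θ * x)))
    (v := fun x : ℝ => ((-(x ^ (-α)) / α : ℝ) : ℂ))
    (v' := fun x : ℝ => ((x ^ (-1 - α) : ℝ) : ℂ))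
    (by
      intro x _
      have h : ∀ w : ℂ, HasDerivAt (fun x : ℝ => Complex.exp (-(w * x)))
          (-w * Complex.exp (-(w * x))) x := by
        intro w
        have h1 : HasDerivAt (fun y : ℝ => -(w * (y : ℂ))) (-(w * 1)) x :=
          (Complex.ofRealCLM.hasDerivAt.const_mul w).neg
        convert! h1.cexp using 1
        ring
      convert! (h z).sub (h θ) using 1
      ring)
    (by
      intro x hx
      have h := ((Real.hasDerivAt_rpow_const (x := x) (p := -α)
        (Or.inl (ne_of_gt hx))).neg).div_const α
      have h2 := h.ofReal_comp
      convert! h2 using 2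
      rw [show -α - 1 = -1 - α by ring]
      field_simp)
    (by
      refine hint.congr_fun (fun x _ => ?_) measurableSet_Ioi
      simp only [Pi.mul_apply]
      rw [hexp]; push_cast; ring)
    (by
      refine IntegrableOn.congr_fun (((hgint z (by simp [hz])).const_mul (z / α)).sub
        ((hgint θ (by simp)).const_mul (θ / α))) (fun x _ => ?_) measurableSet_Ioi
      simp only [Pi.mul_apply, Pi.sub_apply]
      push_cast; field_simp; ring)
    (by
      refine squeeze_zero_norm' (a := fun x : ℝ => |u| / α * (x ^ (1 - α) * Real.exp (-(θ * x))))
        ?_ ?_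
      · filter_upwards [self_mem_nhdsWithin] with x hx
        exact hprod x hx
      · have hc : ContinuousAt (fun x : ℝ => |u| / α * (x ^ (1 - α) * Real.exp (-(θ * x)))) 0 := by
          have := Real.continuousAt_rpow_const (0 : ℝ) (1 - α) (Or.inr (by linarith))
          fun_prop
        have := hc.tendsto
        simp only [Real.zero_rpow (show 1 - α ≠ 0 by linarith), zero_mul, mul_zero] at this
        exact this.mono_left nhdsWithin_le_nhds)
    (by
      refine squeeze_zero_norm' (a := fun x : ℝ => |u| / α * (x ^ (1 - α) * Real.exp (-(θ * x))))
        ?_ ?_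
      · filter_upwards [Filter.eventually_gt_atTop 0] with x hx
        exact hprod x hx
      · have := (tendsto_rpow_mul_exp_neg_mul_atTop_nhds_zero (1 - α) θ hθ).const_mul (|u| / α)
        simpa using this)
  have hlhs : ∫ x in Ioi (0 : ℝ), (Complex.exp (Complex.I * u * x) - 1) *
        ((x ^ (-1 - α) * Real.exp (-(θ * x)) : ℝ) : ℂ) =
      ∫ x in Ioi (0 : ℝ), (Complex.exp (-(z * x)) - Complex.exp (-(θ * x))) *
        ((x ^ (-1 - α) : ℝ) : ℂ) := by
    refine setIntegral_congr_fun measurableSet_Ioi fun x _ => ?_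
    rw [hexp]; push_cast; ring
  have hrhs : ∫ x in Ioi (0 : ℝ), (-z * Complex.exp (-(z * x)) + θ * Complex.exp (-(θ * x))) *
        ((-(x ^ (-α)) / α : ℝ) : ℂ) =
      1 / α * (z * ∫ x in Ioi (0 : ℝ), ((x ^ (-α) : ℝ) : ℂ) * Complex.exp (-(z * x))) -
      1 / α * (θ * ∫ x in Ioi (0 : ℝ), ((x ^ (-α) : ℝ) : ℂ) * Complex.exp (-(θ * x))) := by
    rw [← mul_assoc, ← mul_assoc, ← integral_const_mul, ← integral_const_mul, ← integral_sub
      ((hgint z (by simp [hz])).const_mul _) ((hgint θ (by simp)).const_mul _)]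
    refine setIntegral_congr_fun measurableSet_Ioi fun x _ => ?_
    push_cast; field_simp; ring
  have hG : Real.Gamma (1 - α) = -α * Real.Gamma (-α) := by
    rw [← Real.Gamma_add_one (by linarith), neg_add_eq_sub]
  rw [hlhs, hbp, hrhs, hgamma z (by simp [hz]), hgamma θ (by simp), hG]
  push_cast
  field_simp
  ring

/-- The unnormalised jump density of the compound Poisson component: integrable, with its mass. -/
theorem integral_gamma_mixture {α β a : ℝ} (hα0 : 0 < α) (hα1 : α < 1) (hβ : 0 < β)
    (ha0 : 0 < a) (ha1 : a < 1) :
    IntegrableOn (fun x : ℝ => ∫ v in (1 : ℝ)..(1 / a),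
      x ^ (-α) * (β * v) ^ (1 - α) * Real.exp (-(β * v * x)) / Real.Gamma (1 - α) *
            ((v ^ α - 1) / v)) (Ioi 0) ∧
    ∫ x in Ioi (0 : ℝ), ∫ v in (1 : ℝ)..(1 / a),
      x ^ (-α) * (β * v) ^ (1 - α) * Real.exp (-(β * v * x)) / Real.Gamma (1 - α) *
            ((v ^ α - 1) / v) =
      (1 - a ^ α + a ^ α * Real.log (a ^ α)) / (α * a ^ α) := by
  have h1a : 1 ≤ 1 / a := by rw [le_div_iff₀ ha0]; linarith
  have hΓ : 0 < Real.Gamma (1 - α) := Real.Gamma_pos_of_pos (by linarith)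
  simp only [intervalIntegral.integral_of_le h1a]
  set f : ℝ → ℝ → ℝ := fun x v => x ^ (-α) * (β * v) ^ (1 - α) * Real.exp (-(β * v * x)) /
    Real.Gamma (1 - α) * ((v ^ α - 1) / v) with hf
  have hfactor : ∀ x v, f x v = (β * v) ^ (1 - α) / Real.Gamma (1 - α) * ((v ^ α - 1) / v) *
      (x ^ (-α) * Real.exp (-(β * v * x))) := by
    intro x v; simp only [hf]; ring
  have hxint : ∀ v ∈ Ioc (1 : ℝ) (1 / a), IntegrableOn (fun x => f x v) (Ioi 0) := by
    intro v hv
    have hv0 : 0 < v := by linarith [hv.1]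
    simp only [hfactor]
    exact (integrableOn_rpow_mul_exp_neg_mul_Ioi (by linarith) (by positivity)).const_mul _
  have hxval : ∀ v ∈ Ioc (1 : ℝ) (1 / a), ∫ x in Ioi (0 : ℝ), f x v = (v ^ α - 1) / v := by
    intro v hv
    have hv0 : 0 < v := by linarith [hv.1]
    have hβv : 0 < β * v := by positivity
    have h := Real.integral_rpow_mul_exp_neg_mul_Ioi (a := 1 - α) (by linarith) hβv
    rw [show 1 - α - 1 = -α by ring] at h
    simp only [hfactor]
    rw [integral_const_mul, h, one_div, Real.inv_rpow hβv.le]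
    have := Real.rpow_pos_of_pos hβv (1 - α)
    field_simp
  have hcont : ContinuousOn (fun v : ℝ => (v ^ α - 1) / v) (uIcc 1 (1 / a)) := by
    intro v hv
    rw [uIcc_of_le h1a] at hv
    have hv0 : v ≠ 0 := by linarith [hv.1]
    have := Real.continuousAt_rpow_const v α (Or.inl hv0)
    exact ContinuousAt.continuousWithinAt (by fun_prop (disch := exact hv0))
  have hII := hcont.intervalIntegrable (μ := volume)
  have hprod : Integrable (Function.uncurry f)
      ((volume.restrict (Ioi (0 : ℝ))).prod (volume.restrict (Ioc (1 : ℝ) (1 / a)))) := by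
    have hmeas : Measurable (Function.uncurry f) := by
      simp only [hf, Function.uncurry_def]
      fun_prop
    refine (integrable_prod_iff' hmeas.aestronglyMeasurable).2 ⟨?_, ?_⟩
    · filter_upwards [ae_restrict_mem measurableSet_Ioc] with v hv using hxint v hv
    · have hI := (intervalIntegrable_iff_integrableOn_Ioc_of_le h1a).1 hII
      refine hI.congr_fun (fun v hv => ?_) measurableSet_Ioc
      simp only
      rw [← hxval v hv]
      refine setIntegral_congr_fun measurableSet_Ioi fun x (hx : 0 < x) => ?_
      have hv0 : 0 < v := by linarith [hv.1]
      have hv1 : 0 ≤ v ^ α - 1 := sub_nonneg.2 (Real.one_le_rpow hv.1.le hα0.le)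
      simp only [Function.uncurry_apply_pair]
      rw [Real.norm_of_nonneg]
      simp only [hf]
      positivity
  refine ⟨hprod.integral_prod_left, ?_⟩
  rw [integral_integral_swap hprod, setIntegral_congr_fun measurableSet_Ioc hxval,
    ← intervalIntegral.integral_of_le h1a]
  have hderiv : ∀ v ∈ uIcc (1 : ℝ) (1 / a),
      HasDerivAt (fun v => v ^ α / α - Real.log v) ((v ^ α - 1) / v) v := by
    intro v hv
    rw [uIcc_of_le h1a] at hv
    have hv0 : 0 < v := by linarith [hv.1]
    convert! ((Real.hasDerivAt_rpow_const (p := α) (Or.inl hv0.ne')).div_const α).sub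
      (Real.hasDerivAt_log hv0.ne') using 1
    rw [Real.rpow_sub_one hv0.ne']
    field_simp
  rw [intervalIntegral.integral_eq_sub_of_hasDerivAt hderiv hII, one_div,
    Real.inv_rpow ha0.le, Real.log_inv, Real.log_rpow ha0, Real.one_rpow, Real.log_one]
  have := Real.rpow_pos_of_pos ha0 α
  field_simp
  ring



/-- For `0 < α < 1`, `β, c, b, t > 0`, `a = e^{-bt}`,
`D = 1 − a^α + a^α log(a^α)`, `Λ = (c β^α Γ(1−α)/(b α² a^α)) D` and
`f_J(x) = (α a^α/D) ∫_1^{1/a} (x^{−α}(βv)^{1−α} e^{−βvx}/Γ(1−α)) ((v^α−1)/v) dv`,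
the characteristic exponent of the OU-CTS innovation splits, for all real `u`, as
`∫_0^∞ (e^{iux} − 1) ν_Z(x) dx
  = (c(1−a^α)/(αb)) Γ(−α) [((β/a) − iu)^α − (β/a)^α] + Λ (∫_0^∞ e^{iux} f_J(x) dx − 1)`,
i.e. as the characteristic exponent of a `CTS(α, β/a, c(1−a^α)/(αb))` random variable
plus that of an independent compound Poisson random variable with intensity `Λ`
and jump density `f_J`.  Complex powers are principal powers. -/
theorem ou_cts_innovation_decomposition
    (α β c b t : ℝ) (hα0 : 0 < α) (hα1 : α < 1)
    (hβ : 0 < β) (hc : 0 < c) (hb : 0 < b) (ht : 0 < t)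
    (a : ℝ) (ha : a = Real.exp (-(b * t)))
    (D : ℝ) (hD : D = 1 - a ^ α + a ^ α * Real.log (a ^ α))
    (Λ : ℝ) (hΛ : Λ = c * β ^ α * Real.Gamma (1 - α) / (b * α ^ 2 * a ^ α) * D)
    (fJ : ℝ → ℝ)
    (hfJ : ∀ x, 0 < x →
      fJ x = α * a ^ α / D *
        ∫ v in (1 : ℝ)..(1 / a),
          x ^ (-α) * (β * v) ^ (1 - α) * Real.exp (-(β * v * x)) / Real.Gamma (1 - α) *
            ((v ^ α - 1) / v))
    (νZ : ℝ → ℝ)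
    (hνZ : ∀ x, 0 < x →
      νZ x = c / (b * x) * ∫ y in x..(x / a), Real.exp (-(β * y)) * y ^ (-1 - α))
    (u : ℝ) :
    ∫ x in Ioi (0 : ℝ), (Complex.exp (Complex.I * u * x) - 1) * (νZ x : ℂ) =
      ((c * (1 - a ^ α) / (α * b) : ℝ) : ℂ) * (Real.Gamma (-α) : ℂ) *
          ((((β / a : ℝ) : ℂ) - Complex.I * u) ^ (α : ℂ) - (((β / a : ℝ) : ℂ)) ^ (α : ℂ)) +
        (Λ : ℂ) * ((∫ x in Ioi (0 : ℝ), Complex.exp (Complex.I * u * x) * (fJ x : ℂ)) - 1) := by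
  have ha0 : 0 < a := ha ▸ Real.exp_pos _
  have ha1 : a < 1 := by
    rw [ha, Real.exp_lt_one_iff]
    have := mul_pos hb ht
    linarith
  have hA0 : 0 < a ^ α := Real.rpow_pos_of_pos ha0 α
  have hA1 : a ^ α < 1 := Real.rpow_lt_one ha0.le ha1 hα0
  have hD0 : D ≠ 0 := by
    have h := Real.log_lt_sub_one_of_pos (inv_pos.2 hA0) (by
      intro h; rw [inv_eq_one] at h; linarith)
    rw [Real.log_inv] at h
    have h2 := mul_lt_mul_of_pos_left h hA0
    rw [mul_sub, mul_inv_cancel₀ hA0.ne'] at h2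
    rw [hD]
    nlinarith
  obtain ⟨hJint, hJval⟩ := integral_gamma_mixture hα0 hα1 hβ ha0 ha1
  have hΓ : 0 < Real.Gamma (1 - α) := Real.Gamma_pos_of_pos (by linarith)
  have hfJint : IntegrableOn fJ (Ioi 0) :=
    IntegrableOn.congr_fun (hJint.const_mul (α * a ^ α / D)) (fun x hx => (hfJ x hx).symm) measurableSet_Ioi
  have hfJone : ∫ x in Ioi (0 : ℝ), fJ x = 1 := by
    rw [setIntegral_congr_fun measurableSet_Ioi hfJ, integral_const_mul, hJval, ← hD]
    field_simp
  have hsplit : ∀ x, 0 < x → νZ x =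
      c * (1 - a ^ α) / (α * b) * (x ^ (-1 - α) * Real.exp (-(β / a * x))) + Λ * fJ x := by
    intro x hx
    have hker : ∀ v ∈ uIcc (1 : ℝ) (1 / a),
        x ^ (-α) * (β * v) ^ (1 - α) * Real.exp (-(β * v * x)) / Real.Gamma (1 - α) *
            ((v ^ α - 1) / v) =
          x ^ (-α) * β ^ (1 - α) / Real.Gamma (1 - α) *
            (v ^ (-α) * Real.exp (-(β * v * x)) * (v ^ α - 1)) := by
      intro v hv
      rw [uIcc_of_le (by rw [le_div_iff₀ ha0]; linarith)] at hv
      have hv0 : 0 < v := by linarith [hv.1]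
      rw [Real.mul_rpow hβ.le hv0.le, sub_eq_add_neg 1 α, Real.rpow_one_add' hv0.le (by linarith)]
      field_simp
    have hβp : β ^ α * β ^ (1 - α) = β := by
      rw [← Real.rpow_add hβ]; simp
    have hxp : x ^ (-α) = x * x ^ (-1 - α) := by
      rw [← Real.rpow_one_add' hx.le (by linarith)]; congr 1; ring
    rw [hνZ x hx, hfJ x hx, integral_exp_neg_mul_rpow_eq α β a x hα0 ha0 ha1 hx,
      intervalIntegral.integral_congr hker, intervalIntegral.integral_const_mul, hΛ, hxp]
    generalize ∫ v in (1 : ℝ)..(1 / a), v ^ (-α) * Real.exp (-(β * v * x)) * (v ^ α - 1) = S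
    generalize Real.exp (-(β / a * x)) = E
    generalize x ^ (-1 - α) = X
    nth_rewrite 1 [← hβp]
    field_simp
  obtain ⟨hTint, hTval⟩ :=
    integral_exp_sub_one_mul_tempered_stable hα0 hα1 (div_pos hβ ha0) u
  have hfJc : IntegrableOn (fun x => (fJ x : ℂ)) (Ioi 0) := hfJint.ofReal
  have hEint : IntegrableOn (fun x : ℝ => Complex.exp (Complex.I * u * x) * (fJ x : ℂ)) (Ioi 0) := by
    refine hfJc.bdd_mul (c := 1) (Measurable.aestronglyMeasurable (by fun_prop)) ?_
    filter_upwards with x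
    rw [Complex.norm_exp]
    simp
  have hJc : (∫ x in Ioi (0 : ℝ), Complex.exp (Complex.I * u * x) * (fJ x : ℂ)) - 1 =
      ∫ x in Ioi (0 : ℝ), (Complex.exp (Complex.I * u * x) * (fJ x : ℂ) - (fJ x : ℂ)) := by
    rw [integral_sub hEint hfJc, integral_complex_ofReal, hfJone, Complex.ofReal_one]
  have hJcint : IntegrableOn (fun x : ℝ =>
      Complex.exp (Complex.I * u * x) * (fJ x : ℂ) - (fJ x : ℂ)) (Ioi 0) := hEint.sub hfJc
  rw [mul_assoc, ← hTval, hJc, ← integral_const_mul, ← integral_const_mul,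
    ← integral_add (hTint.const_mul _) (hJcint.const_mul _)]
  refine setIntegral_congr_fun measurableSet_Ioi fun x hx => ?_
  rw [hsplit x hx]
  push_cast
  ring
end

section
/- Let 0 < α < 1, β > 0, c > 0, b > 0, t > 0 and set a = e^{-bt}. The function x ↦ ν_Z(x) − (c(1 − a^α)/(α b)) x^{−1−α} e^{−(β/a)x} is nonnegative and Lebesgue integrable on (0, ∞), and ∫_0^∞ [ ν_Z(x) − (c(1 − a^α)/(α b)) x^{−1−α} e^{−(β/a)x} ] dx = (c β^α Γ(1−α)/(b α² a^α)) (1 − a^α + a^α log(a^α)), i.e. the excess Lévy mass of the innovation over the CTS(α, β/a, c(1−a^α)/(αb)) component equals the Poisson intensity Λ of the compound Poisson remainder. -/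
open MeasureTheory Set

lemma exp_sub_exp_le_mul_exp (p q x : ℝ) :
    Real.exp (-(p * x)) - Real.exp (-(q * x)) ≤ (q - p) * x * Real.exp (-(p * x)) := by
  have h1 : Real.exp (-(q * x)) = Real.exp (-((q - p) * x)) * Real.exp (-(p * x)) := by
    rw [← Real.exp_add]; ring_nf
  have h2 := Real.add_one_le_exp (-((q - p) * x))
  have h3 := Real.exp_pos (-(p * x))
  rw [h1]
  nlinarith

lemma exp_sub_exp_nonneg {p q x : ℝ} (hpq : p ≤ q) (hx : 0 ≤ x) :
    0 ≤ Real.exp (-(p * x)) - Real.exp (-(q * x)) := by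
  rw [sub_nonneg]
  gcongr

lemma integrableOn_rpow_neg_mul_exp {α p : ℝ} (hα1 : α < 1) (hp : 0 < p) :
    IntegrableOn (fun x : ℝ => x ^ (-α) * Real.exp (-(p * x))) (Ioi 0) := by
  simpa using integrableOn_rpow_mul_exp_neg_mul_rpow (p := 1) (s := -α) (by linarith) one_pos hp

lemma integral_rpow_neg_mul_exp {α p : ℝ} (hα1 : α < 1) (hp : 0 < p) :
    ∫ x in Ioi (0 : ℝ), x ^ (-α) * Real.exp (-(p * x)) = p ^ (α - 1) * Real.Gamma (1 - α) := by
  have h := Real.integral_rpow_mul_exp_neg_mul_Ioi (a := 1 - α) (by linarith) hp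
  rw [show 1 - α - 1 = -α by ring] at h
  rw [h, one_div, Real.inv_rpow hp.le, ← Real.rpow_neg hp.le, neg_sub]

lemma rpow_mul_exp_sub_exp_le {s p q x : ℝ} (hx : 0 < x) :
    x ^ s * (Real.exp (-(p * x)) - Real.exp (-(q * x))) ≤
      (q - p) * (x ^ (s + 1) * Real.exp (-(p * x))) := by
  calc _ ≤ x ^ s * ((q - p) * x * Real.exp (-(p * x))) := by
        gcongr
        exact exp_sub_exp_le_mul_exp p q x
    _ = _ := by rw [Real.rpow_add_one hx.ne']; ring

lemma integrableOn_rpow_mul_exp_sub_exp {α p q : ℝ} (hα1 : α < 1) (hp : 0 < p) (hpq : p ≤ q) :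
    IntegrableOn (fun x : ℝ => x ^ (-1 - α) * (Real.exp (-(p * x)) - Real.exp (-(q * x))))
      (Ioi 0) := by
  refine Integrable.mono' ((integrableOn_rpow_neg_mul_exp hα1 hp).const_mul (q - p))
    (by fun_prop) ?_
  filter_upwards [ae_restrict_mem measurableSet_Ioi] with x hx
  have hx : 0 < x := hx
  rw [Real.norm_of_nonneg (mul_nonneg (by positivity) (exp_sub_exp_nonneg hpq hx.le))]
  have h := rpow_mul_exp_sub_exp_le (s := -1 - α) (p := p) (q := q) hx
  rwa [show -1 - α + 1 = -α by ring] at h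

lemma integral_rpow_mul_exp_sub_exp {α p q : ℝ} (hα0 : 0 < α) (hα1 : α < 1) (hp : 0 < p)
    (hpq : p ≤ q) :
    ∫ x in Ioi (0 : ℝ), x ^ (-1 - α) * (Real.exp (-(p * x)) - Real.exp (-(q * x))) =
      Real.Gamma (1 - α) / α * (q ^ α - p ^ α) := by
  have hq : 0 < q := hp.trans_le hpq
  set G : ℝ → ℝ := fun x => x ^ (-α) * (Real.exp (-(p * x)) - Real.exp (-(q * x))) with hG
  have hG0 : G 0 = 0 := by simp [hG]
  have hderiv : ∀ x ∈ Ioi (0 : ℝ), HasDerivAt G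
      (-α * (x ^ (-1 - α) * (Real.exp (-(p * x)) - Real.exp (-(q * x)))) +
        (q * (x ^ (-α) * Real.exp (-(q * x))) - p * (x ^ (-α) * Real.exp (-(p * x))))) x := by
    intro x hx
    have hx : 0 < x := hx
    have he : ∀ r : ℝ, HasDerivAt (fun y => Real.exp (-(r * y))) (Real.exp (-(r * x)) * -r) x := by
      intro r
      simpa using (((hasDerivAt_id x).const_mul r).neg).exp
    refine ((Real.hasDerivAt_rpow_const (p := -α) (Or.inl hx.ne')).mul
      ((he p).sub (he q))).congr_deriv ?_
    rw [show -1 - α = -α - 1 by ring]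
    simp only [Pi.sub_apply]
    ring
  have hbound : ∀ x, 0 < x → 0 ≤ G x ∧ G x ≤ (q - p) * (x ^ (1 - α) * Real.exp (-p * x)) := by
    intro x hx
    refine ⟨mul_nonneg (by positivity) (exp_sub_exp_nonneg hpq hx.le), ?_⟩
    have h := rpow_mul_exp_sub_exp_le (s := -α) (p := p) (q := q) hx
    rw [neg_mul p x, ← neg_add_eq_sub α 1]
    exact h
  have hcont : ContinuousWithinAt G (Ici 0) 0 := by
    rw [← continuousWithinAt_Ioi_iff_Ici, ContinuousWithinAt, hG0]
    have hlim : Filter.Tendsto (fun x : ℝ => (q - p) * (x ^ (1 - α) * Real.exp (-p * x)))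
        (nhdsWithin 0 (Ioi 0)) (nhds 0) := by
      have hc : ContinuousAt (fun x : ℝ => (q - p) * (x ^ (1 - α) * Real.exp (-p * x))) 0 := by
        have := Real.continuousAt_rpow_const 0 (1 - α) (Or.inr (by linarith))
        fun_prop
      have := hc.tendsto
      simp only [Real.zero_rpow (by linarith : 1 - α ≠ 0), zero_mul, mul_zero] at this
      exact this.mono_left nhdsWithin_le_nhds
    refine squeeze_zero' ?_ ?_ hlim
    · filter_upwards [self_mem_nhdsWithin] with x hx using (hbound x hx).1
    · filter_upwards [self_mem_nhdsWithin] with x hx using (hbound x hx).2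
  have htop : Filter.Tendsto G Filter.atTop (nhds 0) := by
    have hlim := (tendsto_rpow_mul_exp_neg_mul_atTop_nhds_zero (1 - α) p hp).const_mul (q - p)
    rw [mul_zero] at hlim
    refine squeeze_zero' ?_ ?_ hlim
    · filter_upwards [Filter.eventually_gt_atTop 0] with x hx using (hbound x hx).1
    · filter_upwards [Filter.eventually_gt_atTop 0] with x hx using (hbound x hx).2
  have hI := (integrableOn_rpow_mul_exp_sub_exp hα1 hp hpq).const_mul (-α)
  have hIp := (integrableOn_rpow_neg_mul_exp hα1 hp).const_mul p
  have hIq := (integrableOn_rpow_neg_mul_exp hα1 hq).const_mul q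
  have key := integral_Ioi_of_hasDerivAt_of_tendsto hcont hderiv (hI.add (hIq.sub hIp)) htop
  rw [integral_add hI (g := fun x => _ - _) (hIq.sub hIp), integral_sub hIq hIp, integral_const_mul, integral_const_mul,
    integral_const_mul, integral_rpow_neg_mul_exp hα1 hp, integral_rpow_neg_mul_exp hα1 hq,
    hG0, Real.rpow_sub_one hp.ne', Real.rpow_sub_one hq.ne'] at key
  generalize (∫ x in Ioi (0 : ℝ),
    x ^ (-1 - α) * (Real.exp (-(p * x)) - Real.exp (-(q * x)))) = I at key ⊢
  field_simp at key ⊢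
  linarith

lemma integral_rpow_neg_one_sub {α a : ℝ} (hα0 : 0 < α) (ha0 : 0 < a) :
    ∫ u in (1 : ℝ)..(1 / a), u ^ (-1 - α) = (1 - a ^ α) / α := by
  have h0 : (0 : ℝ) ∉ uIcc 1 (1 / a) := notMem_uIcc_of_lt one_pos (by positivity)
  rw [integral_rpow (Or.inr ⟨by linarith, h0⟩), show -1 - α + 1 = -α by ring, Real.one_rpow,
    one_div, Real.inv_rpow ha0.le, Real.rpow_neg ha0.le, inv_inv]
  field_simp
  ring

/-- The excess Lévy density as a mixture over the scaling variable `u = y / x`. -/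
lemma excess_density_eq_integral {α β c b a x : ℝ} (hα0 : 0 < α) (ha0 : 0 < a) (hb : 0 < b)
    (hx : 0 < x) :
    c / (b * x) * (∫ y in x..(x / a), Real.exp (-(β * y)) * y ^ (-1 - α)) -
        c * (1 - a ^ α) / (α * b) * x ^ (-1 - α) * Real.exp (-(β / a * x)) =
      c / b * ∫ u in (1 : ℝ)..(1 / a), u ^ (-1 - α) *
        (x ^ (-1 - α) * (Real.exp (-(β * u * x)) - Real.exp (-(β / a * x)))) := by
  have h0 : (0 : ℝ) ∉ uIcc 1 (1 / a) := notMem_uIcc_of_lt one_pos (by positivity)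
  have hpow : ContinuousOn (fun u : ℝ => u ^ (-1 - α)) (uIcc 1 (1 / a)) := fun u hu =>
    (Real.continuousAt_rpow_const u _ (Or.inl fun h => h0 (h ▸ hu))).continuousWithinAt
  have h1 : (∫ y in x..(x / a), Real.exp (-(β * y)) * y ^ (-1 - α)) =
      x * (x ^ (-1 - α) * ∫ u in (1 : ℝ)..(1 / a), u ^ (-1 - α) * Real.exp (-(β * u * x))) := by
    have h := intervalIntegral.smul_integral_comp_mul_left (a := 1) (b := 1 / a)
      (fun y : ℝ => Real.exp (-(β * y)) * y ^ (-1 - α)) x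
    rw [mul_one, mul_one_div, smul_eq_mul] at h
    rw [← h, ← intervalIntegral.integral_const_mul (x ^ (-1 - α))]
    congr 1
    refine intervalIntegral.integral_congr fun u hu => ?_
    have hu0 : 0 < u := (lt_min one_pos (by positivity)).trans_le hu.1
    rw [Real.mul_rpow hx.le hu0.le, show β * (x * u) = β * u * x by ring]
    ring
  have h2 : (∫ u in (1 : ℝ)..(1 / a), u ^ (-1 - α) *
        (x ^ (-1 - α) * (Real.exp (-(β * u * x)) - Real.exp (-(β / a * x))))) =
      x ^ (-1 - α) * (∫ u in (1 : ℝ)..(1 / a), u ^ (-1 - α) * Real.exp (-(β * u * x))) -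
        x ^ (-1 - α) * Real.exp (-(β / a * x)) * ((1 - a ^ α) / α) := by
    rw [← integral_rpow_neg_one_sub hα0 ha0, ← intervalIntegral.integral_const_mul,
      ← intervalIntegral.integral_const_mul, ← intervalIntegral.integral_sub]
    · congr 1
      ext u
      ring
    · exact ((hpow.mul (by fun_prop)).const_mul _).intervalIntegrable
    · exact (hpow.const_mul _).intervalIntegrable
  rw [h1, h2]
  field_simp

lemma integral_rpow_mul_rpow_sub_rpow {α β a : ℝ} (hα0 : 0 < α) (hβ : 0 < β) (ha0 : 0 < a) :
    ∫ u in (1 : ℝ)..(1 / a), u ^ (-1 - α) * ((β / a) ^ α - (β * u) ^ α) =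
      β ^ α / (α * a ^ α) * (1 - a ^ α + a ^ α * Real.log (a ^ α)) := by
  have h0 : (0 : ℝ) ∉ uIcc 1 (1 / a) := notMem_uIcc_of_lt one_pos (by positivity)
  have hpow : ContinuousOn (fun u : ℝ => u ^ (-1 - α)) (uIcc 1 (1 / a)) := fun u hu =>
    (Real.continuousAt_rpow_const u _ (Or.inl fun h => h0 (h ▸ hu))).continuousWithinAt
  have hinv : ContinuousOn (fun u : ℝ => 1 / u) (uIcc 1 (1 / a)) :=
    continuousOn_const.div continuousOn_id fun u hu h => h0 (h ▸ hu)
  have h : (∫ u in (1 : ℝ)..(1 / a), u ^ (-1 - α) * ((β / a) ^ α - (β * u) ^ α)) =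
      ∫ u in (1 : ℝ)..(1 / a), ((β / a) ^ α * u ^ (-1 - α) - β ^ α * (1 / u)) := by
    refine intervalIntegral.integral_congr fun u hu => ?_
    have hu0 : 0 < u := (lt_min one_pos (by positivity)).trans_le hu.1
    have hu1 : u ^ (-1 - α) * u ^ α = 1 / u := by
      rw [← Real.rpow_add hu0, sub_add_cancel, Real.rpow_neg_one, one_div]
    rw [Real.mul_rpow hβ.le hu0.le, ← hu1]
    ring
  rw [h, intervalIntegral.integral_sub (hpow.const_mul _).intervalIntegrable
    (hinv.const_mul _).intervalIntegrable, intervalIntegral.integral_const_mul,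
    intervalIntegral.integral_const_mul, integral_one_div h0, integral_rpow_neg_one_sub hα0 ha0,
    Real.div_rpow hβ.le ha0.le, Real.log_rpow ha0, div_one, one_div, Real.log_inv]
  have : 0 < a ^ α := by positivity
  field_simp
  ring

/-- For `0 < α < 1`, `β, c, b, t > 0` and `a = e^{-bt}`, the excess
`x ↦ ν_Z(x) − (c(1−a^α)/(αb)) x^{−1−α} e^{−(β/a)x}` of the innovation Lévy density over
the `CTS(α, β/a, c(1−a^α)/(αb))` Lévy density is nonnegative and Lebesgue integrable on
`(0, ∞)`, with total mass
`∫_0^∞ [ν_Z(x) − (c(1−a^α)/(αb)) x^{−1−α} e^{−(β/a)x}] dx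
  = (c β^α Γ(1−α)/(b α² a^α)) (1 − a^α + a^α log(a^α))`,
the Poisson intensity `Λ` of the compound Poisson remainder. -/
theorem ou_cts_excess_levy_mass
    (α β c b t : ℝ) (hα0 : 0 < α) (hα1 : α < 1)
    (hβ : 0 < β) (hc : 0 < c) (hb : 0 < b) (ht : 0 < t)
    (a : ℝ) (ha : a = Real.exp (-(b * t)))
    (νZ : ℝ → ℝ)
    (hνZ : ∀ x, 0 < x →
      νZ x = c / (b * x) * ∫ y in x..(x / a), Real.exp (-(β * y)) * y ^ (-1 - α)) :
    (∀ x ∈ Ioi (0 : ℝ),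
        0 ≤ νZ x - c * (1 - a ^ α) / (α * b) * x ^ (-1 - α) * Real.exp (-(β / a * x))) ∧
      IntegrableOn
        (fun x : ℝ =>
          νZ x - c * (1 - a ^ α) / (α * b) * x ^ (-1 - α) * Real.exp (-(β / a * x)))
        (Ioi 0) volume ∧
      ∫ x in Ioi (0 : ℝ),
          (νZ x - c * (1 - a ^ α) / (α * b) * x ^ (-1 - α) * Real.exp (-(β / a * x))) =
        c * β ^ α * Real.Gamma (1 - α) / (b * α ^ 2 * a ^ α) *
          (1 - a ^ α + a ^ α * Real.log (a ^ α)) := by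
  have ha0 : 0 < a := ha ▸ Real.exp_pos _
  have ha1 : a ≤ 1 := by
    rw [ha, Real.exp_le_one_iff, neg_nonpos]
    positivity
  have h1a : 1 ≤ 1 / a := by rwa [one_le_div ha0]
  set F : ℝ → ℝ → ℝ := fun x u => u ^ (-1 - α) *
    (x ^ (-1 - α) * (Real.exp (-(β * u * x)) - Real.exp (-(β / a * x)))) with hF
  have hle : ∀ u ∈ Ioc 1 (1 / a), β * u ≤ β / a := fun u hu => by
    rw [← mul_one_div β a]
    exact mul_le_mul_of_nonneg_left hu.2 hβ.le
  have hFnn : ∀ x ∈ Ioi (0 : ℝ), ∀ u ∈ Ioc 1 (1 / a), 0 ≤ F x u := fun x hx u hu =>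
    mul_nonneg (Real.rpow_nonneg (by linarith [hu.1]) _) <|
      mul_nonneg (Real.rpow_nonneg (le_of_lt hx) _) (exp_sub_exp_nonneg (hle u hu) (le_of_lt hx))
  have hexcess : ∀ x ∈ Ioi (0 : ℝ),
      νZ x - c * (1 - a ^ α) / (α * b) * x ^ (-1 - α) * Real.exp (-(β / a * x)) =
        c / b * ∫ u in Ioc 1 (1 / a), F x u := fun x hx => by
    rw [hνZ x hx, excess_density_eq_integral hα0 ha0 hb hx,
      intervalIntegral.integral_of_le h1a]
  have hslice : ∀ u ∈ Ioc 1 (1 / a), IntegrableOn (fun x => F x u) (Ioi 0) := fun u hu =>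
    (integrableOn_rpow_mul_exp_sub_exp hα1 (mul_pos hβ (by linarith [hu.1])) (hle u hu)).const_mul _
  have hsliceInt : ∀ u ∈ Ioc 1 (1 / a), ∫ x in Ioi (0 : ℝ), F x u =
      Real.Gamma (1 - α) / α * (u ^ (-1 - α) * ((β / a) ^ α - (β * u) ^ α)) := fun u hu => by
    rw [hF, integral_const_mul, integral_rpow_mul_exp_sub_exp hα0 hα1
      (mul_pos hβ (by linarith [hu.1])) (hle u hu)]
    ring
  have hint : Integrable (Function.uncurry F)
      ((volume.restrict (Ioi (0 : ℝ))).prod (volume.restrict (Ioc 1 (1 / a)))) := by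
    have hmeas : Measurable (Function.uncurry F) := by
      simp only [hF, Function.uncurry_def]
      fun_prop
    rw [integrable_prod_iff' hmeas.aestronglyMeasurable]
    refine ⟨?_, ?_⟩
    · filter_upwards [ae_restrict_mem measurableSet_Ioc] with u hu using hslice u hu
    · have hcont : ContinuousOn (fun u : ℝ => Real.Gamma (1 - α) / α *
          (u ^ (-1 - α) * ((β / a) ^ α - (β * u) ^ α))) (Icc 1 (1 / a)) := by
        refine ContinuousOn.const_mul (ContinuousOn.mul ?_ ?_) _
        · exact continuousOn_id.rpow_const fun u hu => Or.inl (by simp; linarith [hu.1])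
        · exact continuousOn_const.sub
            ((continuousOn_const.mul continuousOn_id).rpow_const fun u hu => Or.inr hα0.le)
      refine (hcont.integrableOn_Icc.mono_set Ioc_subset_Icc_self).congr_fun (fun u hu => ?_)
        measurableSet_Ioc
      simp only
      rw [← hsliceInt u hu]
      refine setIntegral_congr_fun measurableSet_Ioi fun x hx => ?_
      exact (Real.norm_of_nonneg (hFnn x hx u hu)).symm
  refine ⟨fun x hx => ?_, ?_, ?_⟩
  · rw [hexcess x hx]
    exact mul_nonneg (by positivity) (setIntegral_nonneg measurableSet_Ioc (hFnn x hx))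
  · exact IntegrableOn.congr_fun (hint.integral_prod_left.const_mul (c / b))
      (fun x hx => (hexcess x hx).symm) measurableSet_Ioi
  · rw [setIntegral_congr_fun measurableSet_Ioi hexcess, integral_const_mul,
      integral_integral_swap hint, setIntegral_congr_fun measurableSet_Ioc hsliceInt,
      integral_const_mul, ← intervalIntegral.integral_of_le h1a,
      integral_rpow_mul_rpow_sub_rpow hα0 hβ ha0]
    have : 0 < a ^ α := by positivity
    field_simp
end
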